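/- Let a < b be real numbers and let γ = (γ₁,γ₂,γ₃,γ₄) : [a,b] → ℝ⁴ be a horizontal curve in the Engel group. Let S = {t ∈ [a,b] : γ₁ is differentiable at t and γ₁'(t) ≠ 0} (equivalently, the set of t where the derivative of γ exists and is not a scalar multiple of the horizontal direction X₂), and suppose m(S) > 0. Then for every ε > 0 there exists a C¹ horizontal curve Γ : [a,b] → ℝ⁴ in the Engel group such that m{t ∈ [a,b] : Γ(t) = γ(t)} > m(S) − ε. -/

import Mathlib

open MeasureTheory Set

/-- A function `f : ℝ → ℝ` is absolutely continuous on `[a,b]`: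
it is the integral of an (interval) integrable function. -/
def AbsCont (f : ℝ → ℝ) (a b : ℝ) : Prop :=
  ∃ g : ℝ → ℝ, IntervalIntegrable g volume a b ∧
    ∀ t ∈ Icc a b, f t = f a + ∫ s in a..t, g s

/-- A horizontal curve in the Engel group, identified with `ℝ⁴` in exponential
coordinates of the second kind. -/
def HorizontalEngel (γ : ℝ → Fin 4 → ℝ) (a b : ℝ) : Prop :=
  (∀ i, AbsCont (fun t => γ t i) a b) ∧
  ∀ᵐ t ∂(volume.restrict (Icc a b)),
    (∀ i, DifferentiableAt ℝ (fun s => γ s i) t) ∧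
    deriv (fun s => γ s 2) t = γ t 0 * deriv (fun s => γ s 1) t ∧
    deriv (fun s => γ s 3) t = (1/2) * (γ t 0)^2 * deriv (fun s => γ s 1) t

/-- A `C¹` horizontal curve in the Engel group on `[a,b]`. -/
def C1HorizontalEngel (Γ : ℝ → Fin 4 → ℝ) (a b : ℝ) : Prop :=
  (∀ i, ContDiffOn ℝ 1 (fun t => Γ t i) (Icc a b)) ∧
  ∀ t ∈ Icc a b,
    derivWithin (fun s => Γ s 2) (Icc a b) t
      = Γ t 0 * derivWithin (fun s => Γ s 1) (Icc a b) t ∧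
    derivWithin (fun s => Γ s 3) (Icc a b) t
      = (1/2) * (Γ t 0)^2 * derivWithin (fun s => Γ s 1) (Icc a b) t


/-- `(s, t)` is a bounded component of the complement of `K`, with endpoints in `K`. -/
def IsGap (K : Set ℝ) (s t : ℝ) : Prop :=
  s ∈ K ∧ t ∈ K ∧ s < t ∧ Disjoint K (Ioo s t)

/-- The gaps of `K`, as pairs of endpoints. -/
abbrev Gap (K : Set ℝ) := {p : ℝ × ℝ // IsGap K p.1 p.2}

lemma IsGap.eq_of_mem {K : Set ℝ} {s t s' t' τ : ℝ} (h : IsGap K s t) (h' : IsGap K s' t')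
    (hτ : τ ∈ Ioo s t) (hτ' : τ ∈ Ioo s' t') : s = s' ∧ t = t' := by
  obtain ⟨hs, ht, -, hd⟩ := h
  obtain ⟨hs', ht', -, hd'⟩ := h'
  rw [Set.disjoint_left] at hd hd'
  have h1 := hd hs'
  have h2 := hd ht'
  have h3 := hd' hs
  have h4 := hd' ht
  simp only [mem_Ioo, not_and, not_lt] at *
  constructor
  · apply le_antisymm
    · by_contra! hc
      linarith [h3 hc]
    · by_contra! hc
      linarith [h1 hc]
  · apply le_antisymm
    · by_contra! hc
      by_cases h5 : s < t'
      · linarith [h2 h5]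
      · linarith
    · by_contra! hc
      by_cases h5 : s' < t
      · linarith [h4 h5]
      · linarith

lemma Gap.eq_of_mem {K : Set ℝ} {p q : Gap K} {τ : ℝ} (hp : τ ∈ Ioo p.1.1 p.1.2)
    (hq : τ ∈ Ioo q.1.1 q.1.2) : p = q :=
  Subtype.ext (Prod.ext (p.2.eq_of_mem q.2 hp hq).1 (p.2.eq_of_mem q.2 hp hq).2)

lemma Gap.pairwise_disjoint (K : Set ℝ) :
    Pairwise (Function.onFun Disjoint fun p : Gap K => Ioo p.1.1 p.1.2) := fun p q hpq => by
  refine Set.disjoint_left.2 fun τ hp hq => hpq (Gap.eq_of_mem hp hq)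

instance Gap.countable (K : Set ℝ) : Countable (Gap K) := by
  have h : (univ : Set (Gap K)).PairwiseDisjoint fun p => Ioo p.1.1 p.1.2 :=
    fun p _ q _ hpq => Gap.pairwise_disjoint K hpq
  exact Set.countable_univ_iff.1
    (h.countable_of_isOpen (fun _ _ => isOpen_Ioo) fun p _ => nonempty_Ioo.2 p.2.2.2.1)

lemma exists_gap_of_notMem {K : Set ℝ} (hK : IsCompact K) {a b τ : ℝ} (ha : a ∈ K) (hb : b ∈ K)
    (hτ : τ ∈ Icc a b) (hτK : τ ∉ K) : ∃ p : Gap K, τ ∈ Ioo p.1.1 p.1.2 := by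
  obtain ⟨s, ⟨hsK, hsτ⟩, hs⟩ :=
    (hK.inter_right isClosed_Iic).exists_isGreatest ⟨a, ha, hτ.1⟩
  obtain ⟨t, ⟨htK, htτ⟩, ht⟩ :=
    (hK.inter_right isClosed_Ici).exists_isLeast ⟨b, hb, hτ.2⟩
  have h1 : s < τ := lt_of_le_of_ne hsτ (by rintro rfl; exact hτK hsK)
  have h2 : τ < t := lt_of_le_of_ne htτ (by rintro rfl; exact hτK htK)
  refine ⟨⟨(s, t), hsK, htK, h1.trans h2, Set.disjoint_left.2 fun x hx hx' => ?_⟩, h1, h2⟩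
  rcases le_total x τ with h | h
  · exact absurd (hs ⟨hx, h⟩) (not_le.2 hx'.1)
  · exact absurd (ht ⟨hx, h⟩) (not_le.2 hx'.2)

lemma Gap.finite_length_ge {K : Set ℝ} (hK : IsCompact K) {δ : ℝ} (hδ : 0 < δ) :
    {p : Gap K | δ ≤ p.1.2 - p.1.1}.Finite := by
  obtain ⟨R, hR⟩ := hK.isBounded.subset_closedBall 0
  have hfin : volume (⋃ p : Gap K, Ioo p.1.1 p.1.2) ≠ ⊤ := by
    refine ne_top_of_le_ne_top (measure_closedBall_lt_top (x := (0 : ℝ)) (r := R)).ne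
      (measure_mono (iUnion_subset fun p => ?_))
    have h1 := hR p.2.1
    have h2 := hR p.2.2.1
    rw [Real.closedBall_eq_Icc] at *
    exact Ioo_subset_Icc_self.trans (Icc_subset_Icc h1.1 h2.2)
  refine (Measure.finite_const_le_meas_of_disjoint_iUnion volume (ENNReal.ofReal_pos.2 hδ)
    (fun p : Gap K => measurableSet_Ioo) (Gap.pairwise_disjoint K) hfin).subset fun p hp => ?_
  simpa using ENNReal.ofReal_le_ofReal hp

/-- Gluing of continuous functions supported in the gaps of a compact set. -/
lemma exists_continuous_of_gaps {K : Set ℝ} (hK : IsCompact K) (v : Gap K → ℝ → ℝ)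
    (hv : ∀ p, Continuous (v p)) (hv0 : ∀ p, ∀ τ ∉ Ioo p.1.1 p.1.2, v p τ = 0)
    (hsmall : ∀ η > 0, ∃ δ > 0, ∀ p : Gap K, p.1.2 - p.1.1 < δ → ∀ τ, |v p τ| ≤ η) :
    ∃ V : ℝ → ℝ, Continuous V ∧ (∀ τ ∈ K, V τ = 0) ∧
      ∀ p : Gap K, ∀ τ ∈ Ioo p.1.1 p.1.2, V τ = v p τ := by
  have hone : ∀ p : Gap K, ∀ τ ∈ Ioo p.1.1 p.1.2, ∀ q ≠ p, v q τ = 0 := fun p τ hp q hq =>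
    hv0 q τ fun h => hq (Gap.eq_of_mem h hp)
  refine ⟨fun τ => ∑' p, v p τ, ?_, fun τ hτ => ?_, fun p τ hτ => tsum_eq_single p (hone p τ hτ)⟩
  · refine continuous_of_uniform_approx_of_continuous fun u hu => ?_
    obtain ⟨η, hη, hu⟩ := Metric.mem_uniformity_dist.1 hu
    obtain ⟨δ, hδ, h⟩ := hsmall (η / 2) (half_pos hη)
    refine ⟨fun τ => ∑ p ∈ (Gap.finite_length_ge hK hδ).toFinset, v p τ,
      continuous_finsetSum _ fun p _ => hv p, fun τ => hu ?_⟩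
    beta_reduce
    by_cases hτ : ∃ p : Gap K, τ ∈ Ioo p.1.1 p.1.2
    · obtain ⟨p, hp⟩ := hτ
      rw [tsum_eq_single p (hone p τ hp)]
      by_cases hpl : δ ≤ p.1.2 - p.1.1
      · rw [Finset.sum_eq_single p (fun q _ hq => hone p τ hp q hq) (fun hq => by simp [hpl] at hq)]
        simpa using hη
      · rw [Finset.sum_eq_zero fun q hq => hone p τ hp q (by
          rintro rfl; simp at hq; exact hpl (by linarith))]
        have := h p (not_le.1 hpl) τ
        rw [Real.dist_eq, sub_zero]
        linarith
    · push Not at hτ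
      simp [fun p => hv0 p τ (hτ p), hη]
  · have : ∀ p, v p τ = 0 := fun p => hv0 p τ (Set.disjoint_left.1 p.2.2.2.2 hτ)
    simp [this]

/-- An integrable function vanishing on `K` with zero mean on the gaps has zero mean between any
two points of `K`. -/
lemma integral_eq_zero_of_gaps {K : Set ℝ} (hK : IsCompact K) {F : ℝ → ℝ}
    (hF : LocallyIntegrable F) (hF0 : ∀ τ ∈ K, F τ = 0)
    (hgap : ∀ s t, IsGap K s t → ∫ τ in s..t, F τ = 0) {a b : ℝ} (ha : a ∈ K) (hb : b ∈ K)
    (hab : a ≤ b) : ∫ τ in a..b, F τ = 0 := by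
  set K' := K ∩ Icc a b with hK'def
  have hK' : IsCompact K' := hK.inter_right isClosed_Icc
  have hgap' : ∀ p : Gap K', IsGap K p.1.1 p.1.2 := fun ⟨⟨s, t⟩, hs, ht, hst, hd⟩ => by
    refine ⟨hs.1, ht.1, hst, Set.disjoint_left.2 fun x hx hx' => ?_⟩
    exact Set.disjoint_left.1 hd ⟨hx, hs.2.1.trans hx'.1.le, hx'.2.le.trans ht.2.2⟩ hx'
  have hU : Icc a b \ K' = ⋃ p : Gap K', Ioo p.1.1 p.1.2 := by
    ext τ
    simp only [mem_iUnion]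
    constructor
    · rintro ⟨h1, h2⟩
      exact exists_gap_of_notMem hK' ⟨ha, left_mem_Icc.2 hab⟩ ⟨hb, right_mem_Icc.2 hab⟩ h1 h2
    · rintro ⟨p, hp⟩
      refine ⟨⟨p.2.1.2.1.trans hp.1.le, hp.2.le.trans p.2.2.1.2.2⟩, fun h => ?_⟩
      exact Set.disjoint_left.1 p.2.2.2.2 h hp
  have hint : IntegrableOn F (Icc a b) := hF.integrableOn_isCompact isCompact_Icc
  rw [intervalIntegral.integral_of_le hab, ← integral_Icc_eq_integral_Ioc,
    ← integral_inter_add_sdiff hK'.measurableSet hint, hU,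
    integral_iUnion (fun _ => measurableSet_Ioo) (Gap.pairwise_disjoint K')
      (hint.mono_set (hU ▸ sdiff_subset))]
  have h1 : ∫ τ in Icc a b ∩ K', F τ = 0 :=
    setIntegral_eq_zero_of_forall_eq_zero fun τ hτ => hF0 τ hτ.2.1
  have h2 : ∀ p : Gap K', ∫ τ in Ioo p.1.1 p.1.2, F τ = 0 := fun p => by
    rw [← integral_Ioc_eq_integral_Ioo, ← intervalIntegral.integral_of_le p.2.2.2.1.le]
    exact hgap _ _ (hgap' p)
  simp [h1, h2]

lemma locallyIntegrable_intervalIntegrable {f : ℝ → ℝ} (hf : LocallyIntegrable f) (a b : ℝ) :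
    IntervalIntegrable f volume a b :=
  (hf.integrableOn_isCompact isCompact_uIcc).intervalIntegrable

lemma locallyIntegrable_abs {f : ℝ → ℝ} (hf : LocallyIntegrable f) :
    LocallyIntegrable fun x => |f x| :=
  fun x => (hf x).norm

/-- **Lusin's theorem** on the line. -/
lemma lusin {f : ℝ → ℝ} (hf : StronglyMeasurable f) (hfi : LocallyIntegrable f) {A : Set ℝ}
    (hA : MeasurableSet A) (hfin : volume A ≠ ⊤) {ε : ℝ} (hε : 0 < ε) :
    ∃ K ⊆ A, IsCompact K ∧ volume (A \ K) < ENNReal.ofReal ε ∧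
      ∃ g : ℝ → ℝ, Continuous g ∧ EqOn f g K := by
  set F : ℝ → ℝ := fun x => ∫ t in (0 : ℝ)..x, f t with hF
  have hFc : Continuous F := intervalIntegral.continuous_primitive
    (locallyIntegrable_intervalIntegrable hfi) 0
  set φ : ℕ → ℝ → ℝ := fun n x => (1 / ((n : ℝ) + 1))⁻¹ * (F (x + 1 / ((n : ℝ) + 1)) - F x) with hφ
  have hφc : ∀ n, Continuous (φ n) := fun n => by fun_prop
  have hlim : ∀ᵐ x, Filter.Tendsto (fun n => φ n x) Filter.atTop (nhds (f x)) := by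
    filter_upwards [LocallyIntegrable.ae_hasDerivAt_integral hfi] with x hx
    have h1 := (hasDerivAt_iff_tendsto_slope_zero.1 (hx 0)).comp
      (tendsto_nhdsWithin_iff.2 ⟨tendsto_one_div_add_atTop_nhds_zero_nat (𝕜 := ℝ),
        Filter.Eventually.of_forall fun n => by
          have : (0:ℝ) < 1 / ((n : ℝ) + 1) := by positivity
          exact this.ne'⟩)
    exact h1
  obtain ⟨t, htA, ht, htε, hunif⟩ := tendstoUniformlyOn_of_ae_tendsto
    (fun n => (hφc n).stronglyMeasurable) hf hA hfin (hlim.mono fun x hx _ => hx)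
    (half_pos hε)
  obtain ⟨K, hKA, hK, hKε⟩ := (hA.diff ht).exists_isCompact_sdiff_lt
    (ne_top_of_le_ne_top hfin (measure_mono sdiff_subset))
    (ε := ENNReal.ofReal (ε / 2)) (by simpa using hε)
  refine ⟨K, hKA.trans sdiff_subset, hK, ?_, ?_⟩
  · calc volume (A \ K) ≤ volume (t ∪ ((A \ t) \ K)) := by
          refine measure_mono fun x hx => ?_
          by_cases h : x ∈ t
          · exact Or.inl h
          · exact Or.inr ⟨⟨hx.1, h⟩, hx.2⟩
      _ ≤ volume t + volume ((A \ t) \ K) := measure_union_le _ _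
      _ < ENNReal.ofReal (ε / 2) + ENNReal.ofReal (ε / 2) :=
          ENNReal.add_lt_add_of_le_of_lt (ne_top_of_le_ne_top ENNReal.ofReal_ne_top htε) htε hKε
      _ = ENNReal.ofReal ε := by
          rw [← ENNReal.ofReal_add (by positivity) (by positivity), add_halves]
  · have hcont : ContinuousOn f K := (hunif.mono hKA).continuousOn
      (Filter.Eventually.of_forall fun n => (hφc n).continuousOn).frequently
    obtain ⟨g, hg⟩ := ContinuousMap.exists_restrict_eq hK.isClosed
      ⟨K.domRestrict f, hcont.domRestrict⟩
    exact ⟨g, g.continuous, fun x hx => (congrArg (fun h => h ⟨x, hx⟩) hg).symm⟩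

/-- `φ s τ = o(τ - s)` as `τ` decreases to `s`, uniformly in `s ∈ K`. -/
def UniformLittleO (K : Set ℝ) (φ : ℝ → ℝ → ℝ) : Prop :=
  ∀ η > 0, ∃ δ > 0, ∀ s ∈ K, ∀ τ, s < τ → τ < s + δ → φ s τ ≤ η * (τ - s)

lemma UniformLittleO.mono {K K' : Set ℝ} {φ : ℝ → ℝ → ℝ} (h : UniformLittleO K φ)
    (hK : K' ⊆ K) : UniformLittleO K' φ := fun η hη =>
  let ⟨δ, hδ, h'⟩ := h η hη
  ⟨δ, hδ, fun s hs => h' s (hK hs)⟩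

lemma exists_uniformLittleO_integral {e : ℝ → ℝ} (he : LocallyIntegrable e)
    {K₀ : Set ℝ} (hK₀ : IsCompact K₀) (hz : ∀ s ∈ K₀, e s = 0) {ε : ℝ} (hε : 0 < ε) :
    ∃ K ⊆ K₀, IsCompact K ∧ volume (K₀ \ K) < ENNReal.ofReal ε ∧
      UniformLittleO K fun s τ => ∫ r in s..τ, e r := by
  set E : ℝ → ℝ := fun x => ∫ t in (0 : ℝ)..x, e t with hE
  have hii : ∀ a b, IntervalIntegrable e volume a b := locallyIntegrable_intervalIntegrable he
  have hEc : Continuous E := intervalIntegral.continuous_primitive hii 0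
  have hEsub : ∀ s τ, E τ - E s = ∫ r in s..τ, e r := fun s τ =>
    intervalIntegral.integral_interval_sub_left (hii _ _) (hii _ _)
  set A : ℕ → ℕ → Set ℝ := fun j n =>
    {s | ∀ h : ℝ, 0 < h → h < 1 / ((n : ℝ) + 1) → E (s + h) - E s ≤ 1 / ((j : ℝ) + 1) * h} with hAdef
  have hAcl : ∀ j n, IsClosed (A j n) := fun j n => by
    simp only [hAdef, ofPred_forall]
    refine isClosed_iInter fun h => isClosed_iInter fun _ => isClosed_iInter fun _ => ?_
    exact isClosed_le (by fun_prop) continuous_const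
  have hAmono : ∀ j, Monotone (A j) := fun j m n hmn s hs h h0 h1 => by
    refine hs h h0 (h1.trans_le ?_)
    gcongr
  obtain ⟨ε', hε'0, hε'⟩ := ENNReal.exists_pos_sum_of_countable
    (ε := ENNReal.ofReal ε) (by simpa using hε) ℕ
  have hfin : volume K₀ ≠ ⊤ := hK₀.measure_lt_top.ne
  have hchoose : ∀ j, ∃ n, volume (K₀ \ A j n) < ε' j := fun j => by
    have hzero : volume (⋂ n, K₀ \ A j n) = 0 := by
      have h0 := ae_iff.1 (LocallyIntegrable.ae_hasDerivAt_integral he)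
      refine measure_mono_null (fun s hs => mem_ofPred.2 fun hd => ?_) h0
      have hsK : s ∈ K₀ := (mem_iInter.1 hs 0).1
      have hd : HasDerivAt E (e s) s := hd 0
      rw [hz s hsK] at hd
      have h1 := (hasDerivAt_iff_isLittleO.1 hd).def
        (show (0 : ℝ) < 1 / ((j : ℝ) + 1) by positivity)
      obtain ⟨δ, hδ, hball⟩ := Metric.eventually_nhds_iff.1 h1
      obtain ⟨n, hn⟩ := exists_nat_one_div_lt hδ
      refine (mem_iInter.1 hs n).2 fun h h0 h2 => ?_
      have h3 := hball (y := s + h) (by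
        rw [Real.dist_eq, add_sub_cancel_left, abs_of_pos h0]; linarith)
      simp only [smul_zero, sub_zero, add_sub_cancel_left, Real.norm_eq_abs, abs_of_pos h0] at h3
      exact (le_abs_self _).trans h3
    have hanti : Antitone fun n => K₀ \ A j n := fun m n hmn => sdiff_subset_sdiff_right (hAmono j hmn)
    have := tendsto_measure_iInter_atTop (μ := volume) (s := fun n => K₀ \ A j n)
      (fun n => (hK₀.measurableSet.diff (hAcl j n).measurableSet).nullMeasurableSet) hanti
      ⟨0, ne_top_of_le_ne_top hfin (measure_mono sdiff_subset)⟩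
    rw [hzero] at this
    exact (this.eventually_lt_const (by simpa using hε'0 j)).exists
  choose n hn using hchoose
  refine ⟨K₀ ∩ ⋂ j, A j (n j), inter_subset_left,
    hK₀.inter_right (isClosed_iInter fun j => hAcl _ _), ?_, fun η hη => ?_⟩
  · rw [sdiff_self_inter, sdiff_iInter]
    refine (measure_iUnion_le _).trans_lt (lt_of_le_of_lt ?_ hε')
    exact ENNReal.tsum_le_tsum fun j => (hn j).le
  · obtain ⟨j, hj⟩ := exists_nat_one_div_lt hη
    refine ⟨1 / ((n j : ℝ) + 1), by positivity, fun s hs τ h1 h2 => ?_⟩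
    have := mem_iInter.1 hs.2 j (τ - s) (by linarith) (by linarith)
    rw [add_sub_cancel, hEsub] at this
    nlinarith

/-- Lusin approximation with uniform Lebesgue points. -/
lemma exists_lusin_uniform {f : ℝ → ℝ} (hf : StronglyMeasurable f) (hfi : LocallyIntegrable f)
    {A : Set ℝ} (hA : MeasurableSet A) (hfin : volume A ≠ ⊤) {ε : ℝ} (hε : 0 < ε) :
    ∃ K ⊆ A, IsCompact K ∧ volume (A \ K) < ENNReal.ofReal ε ∧
      ∃ g : ℝ → ℝ, Continuous g ∧ EqOn f g K ∧
        UniformLittleO K fun s τ => ∫ r in s..τ, |f r - g r| := by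
  obtain ⟨K₀, hK₀A, hK₀, hm₀, g, hg, hfg⟩ := lusin hf hfi hA hfin (half_pos hε)
  obtain ⟨K, hKK₀, hK, hm, hu⟩ := exists_uniformLittleO_integral
    (e := fun r => |f r - g r|) (locallyIntegrable_abs (hfi.sub hg.locallyIntegrable)) hK₀
    (fun s hs => by simp [hfg hs]) (half_pos hε)
  refine ⟨K, hKK₀.trans hK₀A, hK, ?_, g, hg, hfg.mono hKK₀, hu⟩
  calc volume (A \ K) ≤ volume ((A \ K₀) ∪ (K₀ \ K)) := by
        refine measure_mono fun x hx => ?_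
        by_cases h : x ∈ K₀
        · exact Or.inr ⟨h, hx.2⟩
        · exact Or.inl ⟨hx.1, h⟩
    _ ≤ volume (A \ K₀) + volume (K₀ \ K) := measure_union_le _ _
    _ < ENNReal.ofReal (ε / 2) + ENNReal.ofReal (ε / 2) := ENNReal.add_lt_add hm₀ hm
    _ = ENNReal.ofReal ε := by
        rw [← ENNReal.ofReal_add (by positivity) (by positivity), add_halves]

/-- A polynomial vanishing at `0` and `1` with prescribed first three moments on `[0, 1]`. -/
lemma exists_polynomial_moments (m : Fin 3 → ℝ) :
    ∃ P : ℝ → ℝ, Continuous P ∧ P 0 = 0 ∧ P 1 = 0 ∧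
      (∀ i : Fin 3, ∫ r in (0 : ℝ)..1, r ^ (i : ℕ) * P r = m i) ∧
      ∀ R B : ℝ, 1 ≤ R → (∀ i, |m i| ≤ B) → ∀ r, |r| ≤ R → |P r| ≤ 20880 * R ^ 4 * B := by
  set c₀ := 120 * m 0 - 480 * m 1 + 420 * m 2 with hc₀
  set c₁ := -480 * m 0 + 2220 * m 1 - 2100 * m 2 with hc₁
  set c₂ := 420 * m 0 - 2100 * m 1 + 2100 * m 2 with hc₂
  refine ⟨fun r => r * (1 - r) * (c₀ + c₁ * r + c₂ * r ^ 2), by fun_prop, by simp, by simp,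
    fun i => ?_, fun R B hR hB r hr => ?_⟩
  · have key : ∀ k : ℕ, ∫ r in (0 : ℝ)..1, r ^ k * (r * (1 - r) * (c₀ + c₁ * r + c₂ * r ^ 2)) =
        c₀ * (1 / (k + 2) - 1 / (k + 3)) + c₁ * (1 / (k + 3) - 1 / (k + 4)) +
          c₂ * (1 / (k + 4) - 1 / (k + 5)) := fun k => by
      have h : ∀ r : ℝ, r ^ k * (r * (1 - r) * (c₀ + c₁ * r + c₂ * r ^ 2)) =
          c₀ * r ^ (k + 1) + (c₁ - c₀) * r ^ (k + 2) + (c₂ - c₁) * r ^ (k + 3)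
            - c₂ * r ^ (k + 4) := fun r => by ring
      have hi : ∀ (c : ℝ) (n : ℕ), IntervalIntegrable (fun r : ℝ => c * r ^ n) volume 0 1 :=
        fun c n => (by fun_prop : Continuous fun r : ℝ => c * r ^ n).intervalIntegrable _ _
      simp_rw [h]
      rw [intervalIntegral.integral_sub (((hi _ _).add (hi _ _)).add (hi _ _)) (hi _ _),
        intervalIntegral.integral_add ((hi _ _).add (hi _ _)) (hi _ _),
        intervalIntegral.integral_add (hi _ _) (hi _ _)]
      simp only [intervalIntegral.integral_const_mul, integral_pow]
      push_cast
      simp only [one_pow, ne_eq, Nat.add_eq_zero_iff, one_ne_zero, and_false, not_false_eq_true,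
        zero_pow, sub_zero, OfNat.ofNat_ne_zero]
      have e2 : (k : ℝ) + 1 + 1 = k + 2 := by ring
      have e3 : (k : ℝ) + 2 + 1 = k + 3 := by ring
      have e4 : (k : ℝ) + 3 + 1 = k + 4 := by ring
      have e5 : (k : ℝ) + 4 + 1 = k + 5 := by ring
      rw [e2, e3, e4, e5]
      ring
    rw [key, hc₀, hc₁, hc₂]
    fin_cases i
    · norm_num
      ring
    · norm_num
      ring
    · change _ = m 2
      norm_num
      ring
  · have b0 := abs_le.1 (hB 0)
    have b1 := abs_le.1 (hB 1)
    have b2 := abs_le.1 (hB 2)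
    have hB0 : 0 ≤ B := (abs_nonneg _).trans (hB 0)
    have hc₀' : |c₀| ≤ 1020 * B := by rw [abs_le]; constructor <;> linarith
    have hc₁' : |c₁| ≤ 4800 * B := by rw [abs_le]; constructor <;> linarith
    have hc₂' : |c₂| ≤ 4620 * B := by rw [abs_le]; constructor <;> linarith
    have hRR : R ≤ R ^ 2 := by nlinarith
    have h1 : |1 - r| ≤ 2 * R := (abs_sub _ _).trans (by rw [abs_one]; linarith)
    have h2 : |c₀ + c₁ * r + c₂ * r ^ 2| ≤ 10440 * B * R ^ 2 := by
      calc |c₀ + c₁ * r + c₂ * r ^ 2| ≤ |c₀| + |c₁| * |r| + |c₂| * |r| ^ 2 := by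
            rw [← abs_pow, ← abs_mul, ← abs_mul]
            exact abs_add_three _ _ _
        _ ≤ (1020 * B) * R ^ 2 + (4800 * B) * R ^ 2 + (4620 * B) * R ^ 2 := by
            gcongr
            · nlinarith
            · exact hr.trans hRR
        _ = 10440 * B * R ^ 2 := by ring
    calc |r * (1 - r) * (c₀ + c₁ * r + c₂ * r ^ 2)|
        = |r| * |1 - r| * |c₀ + c₁ * r + c₂ * r ^ 2| := by rw [abs_mul, abs_mul]
      _ ≤ R * (2 * R) * (10440 * B * R ^ 2) := by gcongr
      _ = 20880 * R ^ 4 * B := by ring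

/-- A continuous function supported in `[s, t]` with prescribed moments against the powers of
`X - X s`. -/
lemma exists_bump_moments {X ξ : ℝ → ℝ} (hX : ∀ t, HasDerivAt X (ξ t) t) (hξ : Continuous ξ)
    {s t : ℝ} (hst : s < t) (hne : X t ≠ X s) (D : Fin 3 → ℝ) :
    ∃ v : ℝ → ℝ, Continuous v ∧ (∀ τ ∉ Ioo s t, v τ = 0) ∧
      (∀ i : Fin 3, ∫ τ in s..t, (X τ - X s) ^ (i : ℕ) * v τ = D i) ∧
      ∀ R B M c : ℝ, 1 ≤ R → 0 < c → c * (t - s) ≤ |X t - X s| →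
        (∀ τ ∈ Icc s t, |ξ τ| ≤ M) → (∀ τ ∈ Icc s t, |X τ - X s| ≤ R * |X t - X s|) →
        (∀ i : Fin 3, |D i| ≤ B * |X t - X s| ^ (i : ℕ) * (t - s)) →
        ∀ τ, |v τ| ≤ M / c * (20880 * R ^ 4 * B) := by
  set L := X t - X s with hL
  have hL0 : L ≠ 0 := sub_ne_zero.2 hne
  have hLpos : 0 < |L| := abs_pos.2 hL0
  set q : ℝ → ℝ := fun τ => (X τ - X s) / L with hq
  have hXc : Continuous X := continuous_iff_continuousAt.2 fun t => (hX t).continuousAt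
  have hqc : Continuous q := by fun_prop
  have hqd : ∀ τ, HasDerivAt q (ξ τ / L) τ := fun τ => ((hX τ).sub_const _).div_const _
  have hqs : q s = 0 := by simp [hq]
  have hqt : q t = 1 := by simp [hq, ← hL, hL0]
  obtain ⟨P, hPc, hP0, hP1, hPm, hPb⟩ := exists_polynomial_moments fun i => D i / L ^ (i : ℕ)
  set κ : ℝ → ℝ := fun τ => max s (min τ t) with hκ
  have hκc : Continuous κ := by fun_prop
  have hκmem : ∀ τ, κ τ ∈ Icc s t := fun τ => ⟨le_max_left _ _, max_le hst.le (min_le_right _ _)⟩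
  have hκid : ∀ τ ∈ Icc s t, κ τ = τ := fun τ hτ => by simp [hκ, hτ.1, hτ.2]
  refine ⟨fun τ => P (q (κ τ)) * (ξ (κ τ) / L), by fun_prop, fun τ hτ => ?_, fun i => ?_,
    fun R B M c hR hc hcL hM hXR hD τ => ?_⟩
  · rcases le_or_gt τ s with h | h
    · have : κ τ = s := by simp [hκ, h]
      simp [this, hqs, hP0]
    · have : κ τ = t := by
        have h' : t ≤ τ := not_lt.1 fun h' => hτ ⟨h, h'⟩
        simp [hκ, h', hst.le]
      simp [this, hqt, hP1]
  · have h1 : ∫ τ in s..t, (X τ - X s) ^ (i : ℕ) * (P (q (κ τ)) * (ξ (κ τ) / L)) =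
        L ^ (i : ℕ) * ∫ τ in s..t, ((fun r => r ^ (i : ℕ) * P r) ∘ q) τ * (ξ τ / L) := by
      rw [← intervalIntegral.integral_const_mul]
      refine intervalIntegral.integral_congr fun τ hτ => ?_
      rw [uIcc_of_le hst.le] at hτ
      simp only [hκid τ hτ, Function.comp, hq, div_pow]
      field_simp
    rw [h1, intervalIntegral.integral_comp_mul_deriv (fun τ _ => hqd τ)
      (by fun_prop) (by fun_prop), hqs, hqt, hPm]
    field_simp
  · have hst' : 0 < t - s := sub_pos.2 hst
    have h1 : |P (q (κ τ))| ≤ 20880 * R ^ 4 * (B * (t - s)) := by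
      refine hPb R _ hR (fun i => ?_) _ ?_
      · rw [abs_div, abs_pow, div_le_iff₀ (by positivity)]
        linarith [hD i]
      · rw [hq, abs_div, div_le_iff₀ hLpos]
        exact hXR _ (hκmem τ)
    have hM0 : 0 ≤ M := (abs_nonneg _).trans (hM _ (hκmem τ))
    have hB0 : 0 ≤ B := by
      have := (abs_nonneg _).trans (hD 0)
      simp only [Fin.val_zero, pow_zero, mul_one] at this
      exact nonneg_of_mul_nonneg_left this hst'
    rw [abs_mul, abs_div]
    calc |P (q (κ τ))| * (|ξ (κ τ)| / |L|)
        ≤ 20880 * R ^ 4 * (B * (t - s)) * (M / (c * (t - s))) := by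
          gcongr
          exact hM _ (hκmem τ)
      _ = M / c * (20880 * R ^ 4 * B) := by field_simp

lemma exists_bump_moments_of_deriv_ne_zero {X ξ : ℝ → ℝ} (hX : ∀ t, HasDerivAt X (ξ t) t)
    (hξ : Continuous ξ) {s t : ℝ} (hst : s < t) (hs : ξ s ≠ 0) (D : Fin 3 → ℝ) :
    ∃ v : ℝ → ℝ, Continuous v ∧ (∀ τ ∉ Ioo s t, v τ = 0) ∧
      (∀ i : Fin 3, ∫ τ in s..t, (X τ - X s) ^ (i : ℕ) * v τ = D i) ∧
      ∀ R B M c : ℝ, 1 ≤ R → 0 < c → c * (t - s) ≤ |X t - X s| →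
        (∀ τ ∈ Icc s t, |ξ τ| ≤ M) → (∀ τ ∈ Icc s t, |X τ - X s| ≤ R * |X t - X s|) →
        (∀ i : Fin 3, |D i| ≤ B * |X t - X s| ^ (i : ℕ) * (t - s)) →
        ∀ τ, |v τ| ≤ M / c * (20880 * R ^ 4 * B) := by
  by_cases hne : X t = X s
  swap
  · exact exists_bump_moments hX hξ hst hne D
  have hev : ∀ᶠ r in nhdsWithin s (Ioi s), X r ≠ X s :=
    ((hX s).eventually_ne hs).filter_mono (nhdsWithin_mono _ fun r (hr : s < r) => hr.ne')
  obtain ⟨r, hr, hsr, hrt⟩ := (hev.and (Ioo_mem_nhdsGT hst)).exists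
  obtain ⟨v, hv, hv0, hvm, -⟩ := exists_bump_moments hX hξ hsr hr D
  refine ⟨v, hv, fun τ hτ => hv0 τ fun h => hτ ⟨h.1, h.2.trans hrt⟩, fun i => ?_,
    fun R B M c _ hc hcL => ?_⟩
  · have hXc : Continuous X := continuous_iff_continuousAt.2 fun t => (hX t).continuousAt
    have hc : Continuous fun τ => (X τ - X s) ^ (i : ℕ) * v τ := by fun_prop
    rw [← intervalIntegral.integral_add_adjacent_intervals (hc.intervalIntegrable s r)
      (hc.intervalIntegrable r t), hvm, add_eq_left]
    refine intervalIntegral.integral_zero_ae (Filter.Eventually.of_forall fun τ hτ => ?_)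
    rw [uIoc_of_le hrt.le] at hτ
    rw [hv0 τ fun h => h.2.not_gt hτ.1, mul_zero]
  · rw [hne, sub_self, abs_zero] at hcL
    nlinarith [mul_pos hc (sub_pos.2 hst)]

lemma LocallyIntegrable.continuous_mul_left {g h : ℝ → ℝ} (hg : Continuous g)
    (hh : LocallyIntegrable h) : LocallyIntegrable fun τ => g τ * h τ :=
  locallyIntegrable_iff.2 fun _ hk =>
    (hh.integrableOn_isCompact hk).continuousOn_mul hg.continuousOn hk

lemma moment_factor_bounds {a b A θ R : ℝ} (hA : 0 ≤ A) (hθ : 0 ≤ θ) (hθ1 : θ ≤ 1) (hR : 1 ≤ R)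
    (hb : |b| ≤ R * A) (hab : |a - b| ≤ θ * A) (i : Fin 3) :
    |a ^ (i : ℕ) - b ^ (i : ℕ)| ≤ (2 * R + 1) * θ * A ^ (i : ℕ) ∧
      |a| ^ (i : ℕ) ≤ (R + 1) ^ 2 * A ^ (i : ℕ) := by
  have ha : |a| ≤ (R + 1) * A := by
    calc |a| = |(a - b) + b| := by ring_nf
      _ ≤ |a - b| + |b| := abs_add_le _ _
      _ ≤ 1 * A + R * A := add_le_add (hab.trans (by gcongr)) hb
      _ = (R + 1) * A := by ring
  have hθA : 0 ≤ θ * A := mul_nonneg hθ hA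
  fin_cases i
  · simp only [pow_zero, sub_self, abs_zero, mul_one]
    exact ⟨by positivity, by nlinarith⟩
  · simp only [pow_one]
    refine ⟨hab.trans (by nlinarith), ha.trans ?_⟩
    gcongr
    nlinarith
  · change |a ^ 2 - b ^ 2| ≤ _ * A ^ 2 ∧ |a| ^ 2 ≤ _ * A ^ 2
    constructor
    · calc |a ^ 2 - b ^ 2| = |a - b| * |a + b| := by rw [← abs_mul]; ring_nf
        _ ≤ (θ * A) * ((R + 1) * A + R * A) := by
          gcongr
          exact (abs_add_le _ _).trans (add_le_add ha hb)
        _ = (2 * R + 1) * θ * A ^ 2 := by ring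
    · rw [← mul_pow]
      gcongr

lemma abs_moment_defect_le {x X f U₀ : ℝ → ℝ} (hx : Continuous x) (hXc : Continuous X)
    (hf : LocallyIntegrable f) (hU₀ : Continuous U₀) {s t A θ R M₀ : ℝ} (hst : s ≤ t)
    (hA : 0 ≤ A) (hθ : 0 ≤ θ) (hθ1 : θ ≤ 1) (hR : 1 ≤ R)
    (hX : ∀ τ ∈ Icc s t, |X τ - X s| ≤ R * A) (hxX : ∀ τ ∈ Icc s t, |x τ - X τ| ≤ θ * A)
    (hM₀ : ∀ τ ∈ Icc s t, |U₀ τ| ≤ M₀)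
    (hL : ∫ τ in s..t, |f τ - U₀ τ| ≤ θ * (t - s)) (i : Fin 3) :
    |(∫ τ in s..t, (x τ - X s) ^ (i : ℕ) * f τ) -
      ∫ τ in s..t, (X τ - X s) ^ (i : ℕ) * U₀ τ| ≤
        θ * ((R + 1) ^ 2 + (2 * R + 1) * M₀) * A ^ (i : ℕ) * (t - s) := by
  have hii := @locallyIntegrable_intervalIntegrable
  have h1 : IntervalIntegrable (fun τ => (x τ - X s) ^ (i : ℕ) * f τ) volume s t :=
    hii (LocallyIntegrable.continuous_mul_left (by fun_prop) hf) _ _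
  have h2 : IntervalIntegrable (fun τ => (X τ - X s) ^ (i : ℕ) * U₀ τ) volume s t :=
    Continuous.intervalIntegrable (by fun_prop) _ _
  have h3 : IntervalIntegrable (fun τ => |f τ - U₀ τ|) volume s t :=
    hii (locallyIntegrable_abs (hf.sub hU₀.locallyIntegrable)) _ _
  have h4 : IntervalIntegrable (fun _ : ℝ => (2 * R + 1) * θ * A ^ (i : ℕ) * M₀) volume s t :=
    intervalIntegrable_const
  rw [← intervalIntegral.integral_sub h1 h2]
  calc |∫ τ in s..t, ((x τ - X s) ^ (i : ℕ) * f τ - (X τ - X s) ^ (i : ℕ) * U₀ τ)|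
      ≤ ∫ τ in s..t, |(x τ - X s) ^ (i : ℕ) * f τ - (X τ - X s) ^ (i : ℕ) * U₀ τ| :=
        intervalIntegral.abs_integral_le_integral_abs hst
    _ ≤ ∫ τ in s..t, ((R + 1) ^ 2 * A ^ (i : ℕ) * |f τ - U₀ τ| +
          (2 * R + 1) * θ * A ^ (i : ℕ) * M₀) := by
        refine intervalIntegral.integral_mono_on hst (h1.sub h2).abs ((h3.const_mul _).add h4)
          fun τ hτ => ?_
        obtain ⟨b1, b2⟩ := moment_factor_bounds (a := x τ - X s) hA hθ hθ1 hR (hX τ hτ)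
          (by simpa using hxX τ hτ) i
        calc |(x τ - X s) ^ (i : ℕ) * f τ - (X τ - X s) ^ (i : ℕ) * U₀ τ|
            = |(x τ - X s) ^ (i : ℕ) * (f τ - U₀ τ) +
                ((x τ - X s) ^ (i : ℕ) - (X τ - X s) ^ (i : ℕ)) * U₀ τ| := by ring_nf
          _ ≤ |x τ - X s| ^ (i : ℕ) * |f τ - U₀ τ| +
                |(x τ - X s) ^ (i : ℕ) - (X τ - X s) ^ (i : ℕ)| * |U₀ τ| := by
              rw [← abs_pow, ← abs_mul, ← abs_mul]
              exact abs_add_le _ _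
          _ ≤ _ := by
              gcongr
              exact hM₀ τ hτ
    _ = (R + 1) ^ 2 * A ^ (i : ℕ) * (∫ τ in s..t, |f τ - U₀ τ|) +
          (2 * R + 1) * θ * A ^ (i : ℕ) * M₀ * (t - s) := by
        rw [intervalIntegral.integral_add (h3.const_mul _) h4,
          intervalIntegral.integral_const_mul, intervalIntegral.integral_const, smul_eq_mul,
          mul_comm (t - s)]
    _ ≤ (R + 1) ^ 2 * A ^ (i : ℕ) * (θ * (t - s)) +
          (2 * R + 1) * θ * A ^ (i : ℕ) * M₀ * (t - s) := by gcongr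
    _ = θ * ((R + 1) ^ 2 + (2 * R + 1) * M₀) * A ^ (i : ℕ) * (t - s) := by ring

/-- Correcting a continuous function in the gaps of `K` to match moments of order at most two. -/
lemma exists_moment_extension {K : Set ℝ} (hK : IsCompact K) {X ξ : ℝ → ℝ}
    (hX : ∀ t, HasDerivAt X (ξ t) t) (hξ : Continuous ξ) (hne : ∀ s ∈ K, ξ s ≠ 0)
    {x f U₀ : ℝ → ℝ} (hx : Continuous x) (hxX : EqOn x X K) (hf : LocallyIntegrable f)
    (hU₀ : Continuous U₀) (hfU : EqOn f U₀ K)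
    (hLeb : UniformLittleO K fun s τ => ∫ r in s..τ, |f r - U₀ r|)
    (hxo : UniformLittleO K fun s τ => |x τ - X τ|) :
    ∃ U : ℝ → ℝ, Continuous U ∧ EqOn f U K ∧
      ∀ a ∈ K, ∀ b ∈ K, a ≤ b → ∀ i : Fin 3,
        ∫ τ in a..b, X τ ^ (i : ℕ) * U τ = ∫ τ in a..b, x τ ^ (i : ℕ) * f τ := by
  have hXc : Continuous X := continuous_iff_continuousAt.2 fun t => (hX t).continuousAt
  have hii := @locallyIntegrable_intervalIntegrable
  set D : Gap K → Fin 3 → ℝ := fun p i =>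
    (∫ τ in p.1.1..p.1.2, (x τ - X p.1.1) ^ (i : ℕ) * f τ) -
      ∫ τ in p.1.1..p.1.2, (X τ - X p.1.1) ^ (i : ℕ) * U₀ τ with hD
  have hxI : ∀ (c : ℝ) (i : ℕ), LocallyIntegrable fun τ => (x τ - c) ^ i * f τ :=
    fun c i => LocallyIntegrable.continuous_mul_left (by fun_prop) hf
  choose v hv hv0 hvm hvb using fun p : Gap K =>
    exists_bump_moments_of_deriv_ne_zero hX hξ p.2.2.2.1 (hne _ p.2.1) (D p)
  have hsmall : ∀ η > 0, ∃ δ > 0, ∀ p : Gap K, p.1.2 - p.1.1 < δ → ∀ τ, |v p τ| ≤ η := by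
    intro η hη
    obtain ⟨R₀, hR₀⟩ := hK.isBounded.subset_closedBall 0
    rw [Real.closedBall_eq_Icc] at hR₀
    set J := Icc (0 - R₀) (0 + R₀) with hJ
    obtain ⟨M', hM'⟩ := isCompact_Icc.exists_bound_of_continuousOn (hξ.continuousOn (s := J))
    obtain ⟨M₀', hM₀'⟩ := isCompact_Icc.exists_bound_of_continuousOn (hU₀.continuousOn (s := J))
    obtain ⟨c₂, hc₂, hc₂K⟩ := hK.exists_forall_le' (f := fun s => |ξ s|)
      hξ.abs.continuousOn (a := 0) fun _ hs => abs_pos.2 (hne _ hs)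
    set c := c₂ / 2 with hc
    have hcpos : 0 < c := half_pos hc₂
    set M := max M' c
    have hM : ∀ τ ∈ J, |ξ τ| ≤ M := fun τ hτ => (hM' τ hτ).trans (le_max_left _ _)
    set M₀ := max M₀' 0
    have hM₀ : ∀ τ ∈ J, |U₀ τ| ≤ M₀ := fun τ hτ => (hM₀' τ hτ).trans (le_max_left _ _)
    have hM₀pos : 0 ≤ M₀ := le_max_right _ _
    have hMpos : 0 < M := hcpos.trans_le (le_max_right _ _)
    set R := M / c with hRdef
    have hR : 1 ≤ R := (one_le_div hcpos).2 (le_max_right _ _)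
    set C := M / c * (20880 * R ^ 4 * ((R + 1) ^ 2 + (2 * R + 1) * M₀)) with hC
    have hCpos : 0 ≤ C := by positivity
    set θ := min 1 (η / (C + 1)) with hθdef
    have hθ : 0 < θ := lt_min one_pos (by positivity)
    have hθ1 : θ ≤ 1 := min_le_left _ _
    have hCθ : C * θ ≤ η := by
      calc C * θ ≤ (C + 1) * (η / (C + 1)) := by
            gcongr
            · linarith
            · exact min_le_right _ _
        _ = η := by field_simp
    obtain ⟨δ₁, hδ₁, h₁⟩ := hLeb θ hθ
    obtain ⟨δ₂, hδ₂, h₂⟩ := hxo (θ * c) (mul_pos hθ hcpos)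
    obtain ⟨δ₃, hδ₃, h₃⟩ := Metric.uniformContinuousOn_iff.1
      (isCompact_Icc.uniformContinuousOn_of_continuous (hξ.continuousOn (s := J))) c hcpos
    refine ⟨min δ₁ (min δ₂ δ₃), by positivity, fun p hp => ?_⟩
    obtain ⟨hsK, htK, hst, -⟩ := p.2
    set s := p.1.1
    set t := p.1.2
    simp only [lt_min_iff] at hp
    obtain ⟨hp₁, hp₂, hp₃⟩ := hp
    have hJst : Icc s t ⊆ J := Icc_subset_Icc (hR₀ hsK).1 (hR₀ htK).2
    have hslope : ∀ τ, s < τ → ∃ r ∈ Ioo s τ, |X τ - X s| = |ξ r| * (τ - s) := fun τ hτ => by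
      obtain ⟨r, hr, hr'⟩ := exists_hasDerivAt_eq_slope X ξ hτ hXc.continuousOn fun y _ => hX y
      refine ⟨r, hr, ?_⟩
      have h0 : 0 < τ - s := sub_pos.2 hτ
      rw [hr', abs_div, abs_of_pos h0, div_mul_cancel₀ _ h0.ne']
    have hL : c * (t - s) ≤ |X t - X s| := by
      obtain ⟨r, hr, hr'⟩ := hslope t hst
      rw [hr']
      have h4 := h₃ r (hJst ⟨hr.1.le, hr.2.le⟩) s (hR₀ hsK)
        (by rw [Real.dist_eq, abs_of_pos (sub_pos.2 hr.1)]; linarith [hr.2])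
      rw [Real.dist_eq] at h4
      have h5 := abs_sub_abs_le_abs_sub (ξ s) (ξ r)
      rw [abs_sub_comm] at h5
      have h6 := hc₂K s hsK
      have : c ≤ |ξ r| := by linarith
      have hts : 0 ≤ t - s := by linarith
      gcongr
    have hX1 : ∀ τ ∈ Icc s t, |X τ - X s| ≤ R * |X t - X s| := fun τ hτ => by
      rcases hτ.1.eq_or_lt with h | h
      · rw [← h, sub_self, abs_zero]
        positivity
      · obtain ⟨r, hr, hr'⟩ := hslope τ h
        have hτs : 0 ≤ τ - s := by linarith
        calc |X τ - X s| = |ξ r| * (τ - s) := hr'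
          _ ≤ M * (t - s) := by
            gcongr
            · exact hM r (hJst ⟨hr.1.le, hr.2.le.trans hτ.2⟩)
            · exact hτ.2
          _ = R * (c * (t - s)) := by rw [hRdef]; field_simp
          _ ≤ R * |X t - X s| := by gcongr
    have hx1 : ∀ τ ∈ Icc s t, |x τ - X τ| ≤ θ * |X t - X s| := fun τ hτ => by
      rcases hτ.1.eq_or_lt with h | h
      · rw [← h, hxX hsK, sub_self, abs_zero]
        positivity
      · calc |x τ - X τ| ≤ θ * c * (τ - s) := h₂ s hsK τ h (by linarith [hτ.2])
          _ ≤ θ * c * (t - s) := by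
            gcongr
            exact hτ.2
          _ = θ * (c * (t - s)) := by ring
          _ ≤ θ * |X t - X s| := by gcongr
    intro τ
    refine (hvb p R (θ * ((R + 1) ^ 2 + (2 * R + 1) * M₀)) M c hR hcpos hL
      (fun τ hτ => hM τ (hJst hτ)) hX1 (fun i => ?_) τ).trans ?_
    · exact abs_moment_defect_le hx hXc hf hU₀ hst.le (abs_nonneg _) hθ.le hθ1 hR hX1 hx1
        (fun τ hτ => hM₀ τ (hJst hτ)) (h₁ s hsK t hst (by linarith)) i
    · refine le_trans (le_of_eq ?_) hCθ
      rw [hC]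
      ring
  obtain ⟨V, hV, hVK, hVv⟩ := exists_continuous_of_gaps hK v hv hv0 hsmall
  have hU : Continuous fun τ => U₀ τ + V τ := hU₀.add hV
  refine ⟨fun τ => U₀ τ + V τ, hU, fun τ hτ => by simp [hVK τ hτ, hfU hτ],
    fun a ha b hb hab i => ?_⟩
  have hXU : ∀ (c : ℝ) (j : ℕ), LocallyIntegrable fun τ => (X τ - c) ^ j * (U₀ τ + V τ) :=
    fun c j => (by fun_prop : Continuous fun τ => (X τ - c) ^ j * (U₀ τ + V τ)).locallyIntegrable
  have hG : ∀ (c : ℝ) (j : ℕ), LocallyIntegrable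
      fun τ => (X τ - c) ^ j * (U₀ τ + V τ) - (x τ - c) ^ j * f τ := fun c j =>
    (hXU c j).sub (hxI c j)
  have hcent : ∀ s t, IsGap K s t → ∀ j : Fin 3,
      ∫ τ in s..t, ((X τ - X s) ^ (j : ℕ) * (U₀ τ + V τ) - (x τ - X s) ^ (j : ℕ) * f τ) = 0 := by
    intro s t hst j
    have h1 : ∫ τ in s..t, (X τ - X s) ^ (j : ℕ) * V τ = D ⟨(s, t), hst⟩ j := by
      rw [← hvm ⟨(s, t), hst⟩ j]
      refine intervalIntegral.integral_congr fun τ hτ => ?_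
      rw [uIcc_of_le hst.2.2.1.le] at hτ
      by_cases h : τ ∈ Ioo s t
      · simp only [hVv ⟨(s, t), hst⟩ τ h]
      · have hτK : τ ∈ K := by
          rcases eq_endpoints_or_mem_Ioo_of_mem_Icc hτ with h' | h' | h'
          · exact h' ▸ hst.1
          · exact h' ▸ hst.2.1
          · exact absurd h' h
        simp only [hVK τ hτK, hv0 ⟨(s, t), hst⟩ τ h]
    have h2 : ∀ W : ℝ → ℝ, Continuous W →
        IntervalIntegrable (fun τ => (X τ - X s) ^ (j : ℕ) * W τ) volume s t := fun W hW =>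
      (by fun_prop : Continuous fun τ => (X τ - X s) ^ (j : ℕ) * W τ).intervalIntegrable _ _
    rw [intervalIntegral.integral_sub (hii (hXU _ _) _ _) (hii (hxI _ _) _ _)]
    simp_rw [mul_add]
    rw [intervalIntegral.integral_add (h2 _ hU₀) (h2 _ hV), h1, hD]
    ring
  have hgap : ∀ s t, IsGap K s t →
      ∫ τ in s..t, ((X τ - 0) ^ (i : ℕ) * (U₀ τ + V τ) - (x τ - 0) ^ (i : ℕ) * f τ) = 0 := by
    intro s t hst
    have h0 := hcent s t hst 0
    have h1 := hcent s t hst 1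
    have h2 := hcent s t hst 2
    have hi : ∀ (c : ℝ) (j : ℕ), IntervalIntegrable
        (fun τ => c * ((X τ - X s) ^ j * (U₀ τ + V τ) - (x τ - X s) ^ j * f τ)) volume s t :=
      fun c j => (hii (hG _ j) _ _).const_mul c
    obtain ⟨α, β, κ, hexp⟩ : ∃ α β κ : ℝ, ∀ X' x' U' f' : ℝ,
        (X' - 0) ^ (i : ℕ) * U' - (x' - 0) ^ (i : ℕ) * f' =
          α * ((X' - X s) ^ 0 * U' - (x' - X s) ^ 0 * f') +
            β * ((X' - X s) ^ 1 * U' - (x' - X s) ^ 1 * f') +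
            κ * ((X' - X s) ^ 2 * U' - (x' - X s) ^ 2 * f') := by
      fin_cases i
      · exact ⟨1, 0, 0, fun _ _ _ _ => by simp⟩
      · exact ⟨X s, 1, 0, fun _ _ _ _ => by simp only; ring⟩
      · exact ⟨X s ^ 2, 2 * X s, 1, fun _ _ _ _ => by simp only; ring⟩
    simp_rw [hexp]
    rw [intervalIntegral.integral_add ((hi _ _).add (hi _ _)) (hi _ _),
      intervalIntegral.integral_add (hi _ _) (hi _ _)]
    simp only [intervalIntegral.integral_const_mul]
    simp only [Fin.val_zero, Fin.val_one, Fin.val_two] at h0 h1 h2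
    rw [h0, h1, h2]
    ring
  have := integral_eq_zero_of_gaps hK (hG 0 i) (fun τ hτ => by simp [hxX hτ, hfU hτ, hVK τ hτ])
    hgap ha hb hab
  rw [intervalIntegral.integral_sub (hii (hXU _ _) _ _) (hii (hxI _ _) _ _), sub_eq_zero] at this
  simpa using this

lemma uniformLittleO_integral_sub {K : Set ℝ} (hK : IsCompact K) {f U₀ U : ℝ → ℝ}
    (hf : LocallyIntegrable f) (hU₀ : Continuous U₀) (hU : Continuous U) (hUU : EqOn U₀ U K)
    (hLeb : UniformLittleO K fun s τ => ∫ r in s..τ, |f r - U₀ r|) :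
    UniformLittleO K fun s τ => |∫ r in s..τ, (f r - U r)| := by
  intro η hη
  obtain ⟨δ₁, hδ₁, h₁⟩ := hLeb (η / 2) (half_pos hη)
  have hd : Continuous fun r => U₀ r - U r := hU₀.sub hU
  obtain ⟨δ₂, hδ₂, h₂⟩ := Metric.mem_uniformity_dist.1
    (hK.uniformContinuousAt_of_continuousAt _ (fun s _ => hd.continuousAt)
      (Metric.dist_mem_uniformity (half_pos hη)))
  refine ⟨min δ₁ δ₂, lt_min hδ₁ hδ₂, fun s hs τ hsτ hτ => ?_⟩
  have hτ₁ : τ < s + δ₁ := hτ.trans_le (by gcongr; exact min_le_left _ _)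
  have hτ₂ : τ < s + δ₂ := hτ.trans_le (by gcongr; exact min_le_right _ _)
  have hsmall : ∀ r ∈ Icc s τ, |U₀ r - U r| ≤ η / 2 := fun r hr => by
    have : dist s r < δ₂ := by
      rw [dist_comm, Real.dist_eq, abs_of_nonneg (sub_nonneg.2 hr.1)]
      linarith [hr.2]
    have h := h₂ this hs
    simp only [mem_ofPred, hUU hs, sub_self, Real.dist_eq, zero_sub, abs_neg] at h
    exact h.le
  have hi : IntervalIntegrable (fun r => |f r - U₀ r|) volume s τ :=
    locallyIntegrable_intervalIntegrable
      (locallyIntegrable_abs (hf.sub hU₀.locallyIntegrable)) _ _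
  calc |∫ r in s..τ, (f r - U r)| ≤ ∫ r in s..τ, |f r - U r| :=
        intervalIntegral.abs_integral_le_integral_abs hsτ.le
    _ ≤ ∫ r in s..τ, (|f r - U₀ r| + η / 2) := by
        refine intervalIntegral.integral_mono_on hsτ.le
          (locallyIntegrable_intervalIntegrable
            (locallyIntegrable_abs (hf.sub hU.locallyIntegrable)) _ _)
          (hi.add intervalIntegrable_const) fun r hr => ?_
        calc |f r - U r| = |(f r - U₀ r) + (U₀ r - U r)| := by ring_nf
          _ ≤ |f r - U₀ r| + |U₀ r - U r| := abs_add_le _ _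
          _ ≤ |f r - U₀ r| + η / 2 := by gcongr; exact hsmall r hr
    _ = (∫ r in s..τ, |f r - U₀ r|) + (τ - s) * (η / 2) := by
        rw [intervalIntegral.integral_add hi intervalIntegrable_const,
          intervalIntegral.integral_const, smul_eq_mul]
    _ ≤ η / 2 * (τ - s) + (τ - s) * (η / 2) := by gcongr; exact h₁ s hs τ hsτ hτ₁
    _ = η * (τ - s) := by ring

lemma AbsCont.exists_stronglyMeasurable {f : ℝ → ℝ} {a b : ℝ} (hab : a < b)
    (h : AbsCont f a b) :
    ∃ g : ℝ → ℝ, StronglyMeasurable g ∧ LocallyIntegrable g ∧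
      (∀ t ∈ Icc a b, f t = f a + ∫ r in a..t, g r) ∧
      ∀ᵐ t ∂volume.restrict (Icc a b), deriv f t = g t := by
  obtain ⟨g₀, hg₀, hfg₀⟩ := h
  have hint : Integrable ((Ioc a b).indicator g₀) :=
    (integrable_indicator_iff measurableSet_Ioc).2
      ((intervalIntegrable_iff_integrableOn_Ioc_of_le hab.le).1 hg₀)
  obtain ⟨g, hg, hgae⟩ := hint.1
  have hgi : LocallyIntegrable g := (hint.congr hgae).locallyIntegrable
  have hfg : ∀ t ∈ Icc a b, f t = f a + ∫ r in a..t, g r := fun t ht => by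
    rw [hfg₀ t ht, intervalIntegral.integral_congr_ae]
    filter_upwards [hgae] with r hr hrt
    rw [uIoc_of_le ht.1] at hrt
    rw [← hr, indicator_of_mem (mem_Ioc.2 ⟨hrt.1, hrt.2.trans ht.2⟩)]
  refine ⟨g, hg, hgi, hfg, ?_⟩
  rw [← restrict_Ioo_eq_restrict_Icc, ae_restrict_iff' measurableSet_Ioo]
  filter_upwards [LocallyIntegrable.ae_hasDerivAt_integral hgi] with t ht htab
  have hev : f =ᶠ[nhds t] fun x => f a + ∫ r in a..x, g r := by
    filter_upwards [Ioo_mem_nhds htab.1 htab.2] with x hx using hfg x (Ioo_subset_Icc_self hx)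
  exact (((ht a).const_add (f a)).congr_of_eventuallyEq hev).deriv

lemma AbsCont.sub_eq_integral {f g : ℝ → ℝ} {a b : ℝ} (hab : a < b) (h : AbsCont f a b)
    (hg : ∀ᵐ t ∂volume.restrict (Icc a b), deriv f t = g t) {s t : ℝ} (hs : s ∈ Icc a b)
    (ht : t ∈ Icc a b) (hst : s ≤ t) : f t - f s = ∫ r in s..t, g r := by
  obtain ⟨g₀, -, hg₀, hfg₀, hd⟩ := h.exists_stronglyMeasurable hab
  have hii := locallyIntegrable_intervalIntegrable hg₀
  rw [hfg₀ t ht, hfg₀ s hs, add_sub_add_left_eq_sub,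
    intervalIntegral.integral_interval_sub_left (hii _ _) (hii _ _)]
  refine intervalIntegral.integral_congr_ae ?_
  rw [ae_restrict_iff' measurableSet_Icc] at hg hd
  filter_upwards [hg, hd] with r h1 h2 hr
  rw [uIoc_of_le hst] at hr
  have hr' : r ∈ Icc a b := ⟨hs.1.trans hr.1.le, hr.2.trans ht.2⟩
  rw [← h1 hr', ← h2 hr']

lemma contDiffOn_primitive {g : ℝ → ℝ} (hg : Continuous g) (c k : ℝ) (s : Set ℝ) :
    ContDiffOn ℝ 1 (fun t => c + ∫ r in k..t, g r) s := by
  have hd : ∀ t, HasDerivAt (fun t => c + ∫ r in k..t, g r) (g t) t := fun t =>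
    (hg.integral_hasStrictDerivAt k t).hasDerivAt.const_add c
  refine (contDiff_one_iff_deriv.2 ⟨fun t => (hd t).differentiableAt, ?_⟩).contDiffOn
  rw [funext fun t => (hd t).deriv]
  exact hg

lemma derivWithin_primitive {g : ℝ → ℝ} (hg : Continuous g) (c k : ℝ) {a b t : ℝ} (hab : a < b)
    (ht : t ∈ Icc a b) :
    derivWithin (fun t => c + ∫ r in k..t, g r) (Icc a b) t = g t :=
  ((hg.integral_hasStrictDerivAt k t).hasDerivAt.const_add c).hasDerivWithinAt.derivWithin
    (uniqueDiffOn_Icc hab t ht)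

/-- The horizontal lift of the planar curve `(X, Y)` with `Y' = U`, based at `p` at time `k`. -/
noncomputable def engelLift (ξ U : ℝ → ℝ) (p : Fin 4 → ℝ) (k : ℝ) (t : ℝ) : Fin 4 → ℝ :=
  ![p 0 + ∫ r in k..t, ξ r,
    p 1 + ∫ r in k..t, U r,
    p 2 + ∫ r in k..t, (p 0 + ∫ q in k..r, ξ q) * U r,
    p 3 + ∫ r in k..t, (1 / 2) * (p 0 + ∫ q in k..r, ξ q) ^ 2 * U r]

lemma c1HorizontalEngel_engelLift {ξ U : ℝ → ℝ} (hξ : Continuous ξ) (hU : Continuous U)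
    (p : Fin 4 → ℝ) (k : ℝ) {a b : ℝ} (hab : a < b) :
    C1HorizontalEngel (engelLift ξ U p k) a b := by
  have hX : Continuous fun r => p 0 + ∫ q in k..r, ξ q :=
    continuous_const.add (intervalIntegral.continuous_primitive
      (fun _ _ => hξ.intervalIntegrable _ _) k)
  have h2 : Continuous fun r => (p 0 + ∫ q in k..r, ξ q) * U r := hX.mul hU
  have h3 : Continuous fun r => (1 / 2) * (p 0 + ∫ q in k..r, ξ q) ^ 2 * U r :=
    (continuous_const.mul (hX.pow 2)).mul hU
  refine ⟨fun i => ?_, fun t ht => ⟨?_, ?_⟩⟩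
  · fin_cases i
    · exact contDiffOn_primitive hξ _ _ _
    · exact contDiffOn_primitive hU _ _ _
    · exact contDiffOn_primitive h2 _ _ _
    · exact contDiffOn_primitive h3 _ _ _
  · exact (derivWithin_primitive h2 _ _ hab ht).trans
      (congrArg _ (derivWithin_primitive hU _ _ hab ht).symm)
  · exact (derivWithin_primitive h3 _ _ hab ht).trans
      (congrArg _ (derivWithin_primitive hU _ _ hab ht).symm)

/-- Lusin approximation in the Engel group off the non-pliable direction:
if the set `S` of times where the tangent is not a multiple of `X₂`
(i.e. `γ₁'` exists and is nonzero) has positive measure, then for every `ε > 0`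
there is a `C¹` horizontal curve agreeing with `γ` on a set of measure
exceeding `m(S) - ε`. -/
theorem engel_partial_lusin (a b : ℝ) (hab : a < b)
    (γ : ℝ → Fin 4 → ℝ) (hγ : HorizontalEngel γ a b)
    (S : Set ℝ)
    (hS : S = {t ∈ Icc a b | DifferentiableAt ℝ (fun s => γ s 0) t ∧
      deriv (fun s => γ s 0) t ≠ 0})
    (hSpos : 0 < volume S) :
    ∀ ε > 0, ∃ Γ : ℝ → Fin 4 → ℝ, C1HorizontalEngel Γ a b ∧
      (volume {t ∈ Icc a b | Γ t = γ t}).toReal > (volume S).toReal - ε := by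
  intro ε hε
  obtain ⟨hac, hhor⟩ := hγ
  obtain ⟨g, hgm, hgi, hxg, hxd⟩ := (hac 0).exists_stronglyMeasurable hab
  obtain ⟨u, hum, hui, -, hyd⟩ := (hac 1).exists_stronglyMeasurable hab
  set x : ℝ → ℝ := fun t => γ a 0 + ∫ r in a..t, g r with hx
  have hgii := locallyIntegrable_intervalIntegrable hgi
  have hxc : Continuous x := continuous_const.add (intervalIntegral.continuous_primitive hgii a)
  have hzd : ∀ᵐ t ∂volume.restrict (Icc a b), deriv (fun s => γ s 2) t = x t * u t := by
    filter_upwards [hhor, hyd, ae_restrict_mem measurableSet_Icc] with t h1 h2 h3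
    rw [h1.2.1, h2, hxg t h3]
  have hwd : ∀ᵐ t ∂volume.restrict (Icc a b),
      deriv (fun s => γ s 3) t = (1 / 2) * (x t ^ 2 * u t) := by
    filter_upwards [hhor, hyd, ae_restrict_mem measurableSet_Icc] with t h1 h2 h3
    rw [h1.2.2, h2, hxg t h3, mul_assoc]
  set A : Set ℝ := Icc a b ∩ {t | g t ≠ 0} with hA
  have hAm : MeasurableSet A :=
    measurableSet_Icc.inter (hgm.measurable (measurableSet_singleton 0).compl)
  have hSA : volume S = volume A := by
    refine measure_congr (Filter.eventuallyEq_set.2 ?_)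
    rw [ae_restrict_iff' measurableSet_Icc] at hhor hxd
    filter_upwards [hhor, hxd] with t h1 h2
    rw [hS, hA]
    refine ⟨fun h => ⟨h.1, ?_⟩, fun h => ⟨h.1, (h1 h.1).1 0, ?_⟩⟩
    · rw [mem_ofPred, ← h2 h.1]
      exact h.2.2
    · rw [h2 h.1]
      exact h.2
  have hAfin : volume A ≠ ⊤ :=
    ne_top_of_le_ne_top isCompact_Icc.measure_lt_top.ne (measure_mono inter_subset_left)
  set ε' := min ε (volume A).toReal with hε'
  have hε'pos : 0 < ε' := lt_min hε (ENNReal.toReal_pos (hSA ▸ hSpos.ne') hAfin)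
  obtain ⟨K₁, hK₁A, hK₁, hm₁, ξ₀, hξ₀, hgξ₀, hLebg⟩ :=
    exists_lusin_uniform hgm hgi hAm hAfin (half_pos hε'pos)
  obtain ⟨K, hKK₁, hK, hm, U₀, hU₀, huU₀, hLebu⟩ :=
    exists_lusin_uniform hum hui hK₁.measurableSet hK₁.measure_lt_top.ne (half_pos hε'pos)
  have hKA := hKK₁.trans hK₁A
  have hmAK : volume (A \ K) < ENNReal.ofReal ε' := by
    calc volume (A \ K) ≤ volume (A \ K₁) + volume (K₁ \ K) :=
          (measure_mono (sdiff_triangle A K₁ K)).trans (measure_union_le _ _)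
      _ < ENNReal.ofReal (ε' / 2) + ENNReal.ofReal (ε' / 2) := ENNReal.add_lt_add hm₁ hm
      _ = ENNReal.ofReal ε' := by
          rw [← ENNReal.ofReal_add (by positivity) (by positivity), add_halves]
  have hKne : K.Nonempty := by
    by_contra! h
    rw [h, sdiff_empty, ← not_le] at hmAK
    refine hmAK ((ENNReal.ofReal_le_ofReal (min_le_right _ _)).trans ?_)
    rw [ENNReal.ofReal_toReal hAfin]
  obtain ⟨k, hk, hkle⟩ := hK.exists_isLeast hKne
  obtain ⟨ξ, hξ, hgξ, hξm⟩ := exists_moment_extension hK (X := id) (x := id) hasDerivAt_id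
    continuous_const (fun _ _ => one_ne_zero) continuous_id (eqOn_refl _ _) hgi hξ₀
    (hgξ₀.mono hKK₁) (hLebg.mono hKK₁) fun η hη =>
      ⟨1, one_pos, fun s _ τ hτ _ => by simpa using mul_nonneg hη.le (sub_nonneg.2 hτ.le)⟩
  set X : ℝ → ℝ := fun t => γ k 0 + ∫ r in k..t, ξ r with hXdef
  have hxγ : ∀ t ∈ K, γ t 0 = x t := fun t ht => hxg t (hKA ht).1
  have hxsub : ∀ s t, x t - x s = ∫ r in s..t, g r := fun s t => by
    rw [hx, add_sub_add_left_eq_sub, intervalIntegral.integral_interval_sub_left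
      (hgii _ _) (hgii _ _)]
  have hXsub : ∀ s t, X t - X s = ∫ r in s..t, ξ r := fun s t => by
    rw [hXdef, add_sub_add_left_eq_sub, intervalIntegral.integral_interval_sub_left
      (hξ.intervalIntegrable _ _) (hξ.intervalIntegrable _ _)]
  have hxX : EqOn x X K := fun t ht => by
    have h1 := hξm k hk t ht (hkle ht) 0
    simp only [Fin.val_zero, pow_zero, one_mul] at h1
    rw [hXdef]
    beta_reduce
    rw [h1, ← hxsub, hxγ k hk]
    ring
  have hxo : UniformLittleO K fun s τ => |x τ - X τ| := by
    intro η hη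
    obtain ⟨δ, hδ, h⟩ := uniformLittleO_integral_sub hK hgi hξ₀ hξ
      (fun s hs => (hgξ₀ (hKK₁ hs)).symm.trans (hgξ hs)) (hLebg.mono hKK₁) η hη
    refine ⟨δ, hδ, fun s hs τ h1 h2 => ?_⟩
    have h3 := h s hs τ h1 h2
    beta_reduce at h3
    rw [intervalIntegral.integral_sub (hgii _ _) (hξ.intervalIntegrable _ _), ← hxsub, ← hXsub,
      hxX hs, sub_sub_sub_cancel_right] at h3
    exact h3
  obtain ⟨U, hU, -, hUm⟩ := exists_moment_extension hK (X := X) (x := x) (f := u)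
    (fun t => (hξ.integral_hasStrictDerivAt k t).hasDerivAt.const_add _) hξ
    (fun s hs => hgξ hs ▸ (hKA hs).2) hxc hxX hui hU₀ huU₀ hLebu hxo
  refine ⟨engelLift ξ U (γ k) k, c1HorizontalEngel_engelLift hξ hU _ _ hab, ?_⟩
  have hagree : K ⊆ {t ∈ Icc a b | engelLift ξ U (γ k) k t = γ t} := fun t ht => by
    have hkt := hkle ht
    have hkab := (hKA hk).1
    have htab := (hKA ht).1
    have h0 := hUm k hk t ht hkt 0
    have h1 := hUm k hk t ht hkt 1
    have h2 := hUm k hk t ht hkt 2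
    simp only [Fin.val_zero, Fin.val_one, Fin.val_two, pow_zero, pow_one, one_mul] at h0 h1 h2
    refine ⟨htab, funext fun i => ?_⟩
    fin_cases i
    · change X t = γ t 0
      rw [← hxX ht, hxγ t ht]
    · change γ k 1 + ∫ r in k..t, U r = γ t 1
      rw [h0, ← (hac 1).sub_eq_integral hab hyd hkab htab hkt]
      ring
    · change γ k 2 + ∫ r in k..t, X r * U r = γ t 2
      rw [h1, ← (hac 2).sub_eq_integral hab hzd hkab htab hkt]
      ring
    · change γ k 3 + ∫ r in k..t, (1 / 2) * X r ^ 2 * U r = γ t 3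
      simp_rw [mul_assoc]
      rw [intervalIntegral.integral_const_mul, h2, ← intervalIntegral.integral_const_mul,
        ← (hac 3).sub_eq_integral hab hwd hkab htab hkt]
      ring
  have hfin : volume {t ∈ Icc a b | engelLift ξ U (γ k) k t = γ t} ≠ ⊤ :=
    ne_top_of_le_ne_top isCompact_Icc.measure_lt_top.ne (measure_mono fun t ht => ht.1)
  have hKle := ENNReal.toReal_mono hfin (measure_mono hagree)
  have hAK : (volume A).toReal = (volume (A \ K)).toReal + (volume K).toReal := by
    rw [← measure_sdiff_add_inter A hK.measurableSet, inter_eq_self_of_subset_right hKA,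
      ENNReal.toReal_add (ne_top_of_le_ne_top hAfin (measure_mono sdiff_subset))
        hK.measure_lt_top.ne]
  have hlt := ENNReal.toReal_lt_of_lt_ofReal hmAK
  rw [hSA]
  linarith [min_le_left ε (volume A).toReal]
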